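/- arXiv:2005.04217 — 2 statements merged into one kernel-verified Lean document; each statement's English description precedes it below -/
import Mathlib

section
/- The rational functions of Hahn type solve the generalized eigenvalue problem Y U = λ X U: for every integer n with 0 ≤ n ≤ N and every integer x, A₁(x) U_n(x+1;α,β,N) + A₂(x) U_n(x−1;α,β,N) + A₀(x) U_n(x;α,β,N) = n(N − β − n) · ((x − α) U_n(x;α,β,N) − x U_n(x−1;α,β,N)). This is the second-order difference equation satisfied by U_n. -/
/-- Pochhammer symbol `(a)_k = a (a+1) ⋯ (a+k-1)`, with `(a)_0 = 1`. -/
noncomputable def poch (a : ℝ) (k : ℕ) : ℝ := ∏ i ∈ Finset.range k, (a + (i : ℝ))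

/-- Coefficients of the difference operator `Y`. -/
noncomputable def A1 (α β : ℝ) (N : ℕ) (x : ℝ) : ℝ := (x - α) * (x - (N : ℝ)) * (x + 1 - α)
noncomputable def A2 (α β : ℝ) (N : ℕ) (x : ℝ) : ℝ := x * (x - α) * (x + β - α - (N : ℝ))
noncomputable def A0 (α β : ℝ) (N : ℕ) (x : ℝ) : ℝ :=
  (x - α) * (-2 * x ^ 2 + (2 * α - 1 + 2 * (N : ℝ) - β) * x - (N : ℝ) * (α - 1))

/-- The rational function of Hahn type `U_n(x;α,β,N)`, written via its
`₃F₂` hypergeometric series. -/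
noncomputable def U (α β : ℝ) (N n : ℕ) (x : ℤ) : ℝ :=
  ((-1 : ℝ) ^ n * poch (-(N : ℝ)) n / poch (β + 1) n) *
    ∑ k ∈ Finset.range (n + 1),
      poch (-(x : ℝ)) k * poch (-(n : ℝ)) k * poch (β + (n : ℝ) - (N : ℝ)) k /
        ((Nat.factorial k : ℝ) * poch (-(N : ℝ)) k * poch (α - (x : ℝ)) k)

theorem poch_succ (a : ℝ) (k : ℕ) : poch a (k + 1) = poch a k * (a + k) := by
  simp [poch, Finset.prod_range_succ]

theorem poch_succ' (a : ℝ) (k : ℕ) : poch a (k + 1) = a * poch (a + 1) k := by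
  simp only [poch, Finset.prod_range_succ']
  rw [mul_comm]
  congr 1
  · simp
  · refine Finset.prod_congr rfl fun i _ => ?_
    push_cast
    ring

theorem poch_ne_zero {a : ℝ} {k : ℕ} (h : ∀ i < k, a + (i : ℝ) ≠ 0) : poch a k ≠ 0 :=
  Finset.prod_ne_zero_iff.mpr fun i hi => h i (Finset.mem_range.mp hi)

/-- The basis functions `(-x)_k / (α - x)_k`. -/
noncomputable def pochRatio (α x : ℝ) (k : ℕ) : ℝ := poch (-x) k / poch (α - x) k

theorem pochRatio_succ (α x : ℝ) (k : ℕ) :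
    pochRatio α x (k + 1) = pochRatio α x k * ((k - x) / (α - x + k)) := by
  rw [pochRatio, pochRatio, poch_succ, poch_succ, mul_div_mul_comm, neg_add_eq_sub]

theorem pochRatio_add_one_succ (α x : ℝ) (k : ℕ) :
    pochRatio α (x + 1) (k + 1) = (x + 1) / (x + 1 - α) * pochRatio α x k := by
  rw [pochRatio, pochRatio, poch_succ', poch_succ', mul_div_mul_comm,
    show -(x + 1) + 1 = -x by ring, show α - (x + 1) + 1 = α - x by ring,
    show α - (x + 1) = -(x + 1 - α) by ring, neg_div_neg_eq]

theorem mul_pochRatio_sub_one {α x : ℝ} (hx : α - x ≠ 0) (k : ℕ) :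
    x * pochRatio α (x - 1) k = (x - α) * pochRatio α x (k + 1) := by
  rw [pochRatio, pochRatio, poch_succ', poch_succ', mul_div_mul_comm,
    show -(x - 1) = -x + 1 by ring, show α - (x - 1) = α - x + 1 by ring]
  field_simp
  ring

/-- The operator `Y` acts on the basis functions by a two-term formula. -/
theorem hahn_Y_pochRatio_succ {α x : ℝ} (β : ℝ) (N : ℕ)
    (hx : ∀ m : ℤ, α - x + m ≠ 0) (k : ℕ) :
    A1 α β N x * pochRatio α (x + 1) (k + 1) + A2 α β N x * pochRatio α (x - 1) (k + 1)
        + A0 α β N x * pochRatio α x (k + 1) =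
      (x - α) * (-((k + 1) * (k + 1 + β - N)) *
          (pochRatio α x (k + 1) - pochRatio α x (k + 2))
        + (k + 1) * (k - N) * (pochRatio α x k - pochRatio α x (k + 1))) := by
  have h0 : α - x ≠ 0 := by simpa using hx 0
  have h1 : x + 1 - α ≠ 0 := fun h => hx (-1) (by push_cast; linarith)
  have h2 : α - x + k ≠ 0 := by simpa using hx k
  have h3 : α - x + (k + 1) ≠ 0 := by simpa using hx (k + 1)
  have hA2 : A2 α β N x * pochRatio α (x - 1) (k + 1) =
      (x - α) * (x + β - α - N) * ((x - α) * pochRatio α x (k + 2)) := by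
    rw [← mul_pochRatio_sub_one h0, A2]
    ring
  rw [hA2, pochRatio_add_one_succ, pochRatio_succ α x (k + 1), pochRatio_succ α x k, A1, A0]
  push_cast
  field_simp
  ring

/-- The coefficient of `pochRatio α x k` in the `₃F₂` series of `U`. -/
noncomputable def hahnCoeff (β : ℝ) (N n k : ℕ) : ℝ :=
  poch (-(n : ℝ)) k * poch (β + n - N) k / ((k.factorial : ℝ) * poch (-(N : ℝ)) k)

theorem hahnCoeff_succ (β : ℝ) {N k : ℕ} (n : ℕ) (hk : k < N) :
    hahnCoeff β N n (k + 1) * ((k + 1) * (k - N)) =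
      hahnCoeff β N n k * ((k - n) * (β + n - N + k)) := by
  have hne : ∀ i < k + 1, -(N : ℝ) + i ≠ 0 := fun i hi h => by
    have : (i : ℝ) = N := by linarith
    have : i = N := by exact_mod_cast this
    omega
  have hp : poch (-(N : ℝ)) k ≠ 0 := poch_ne_zero fun i hi => hne i (by omega)
  have hkN : -(N : ℝ) + k ≠ 0 := hne k (by omega)
  have hf : (k.factorial : ℝ) ≠ 0 := by positivity
  have hk1 : (k : ℝ) + 1 ≠ 0 := by positivity
  simp only [hahnCoeff, poch_succ, Nat.factorial_succ]
  push_cast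
  field_simp
  ring

theorem U_eq_sum (α β : ℝ) (N n : ℕ) (x : ℤ) :
    U α β N n x = ((-1 : ℝ) ^ n * poch (-(N : ℝ)) n / poch (β + 1) n) *
      ∑ k ∈ Finset.range (n + 1), hahnCoeff β N n k * pochRatio α x k := by
  rw [U]
  congr 1
  refine Finset.sum_congr rfl fun k _ => ?_
  rw [hahnCoeff, pochRatio, div_mul_div_comm]
  congr 1
  ring

/-- Partial sums of the series of `U` satisfy the generalized eigenvalue equation up to a
boundary term. -/
theorem sum_hahn_sub_eigen {α x : ℝ} (β : ℝ) {N : ℕ} (n : ℕ)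
    (hx : ∀ m : ℤ, α - x + m ≠ 0) {m : ℕ} (hm : m ≤ N) :
    ∑ k ∈ Finset.range (m + 1), hahnCoeff β N n k *
      (A1 α β N x * pochRatio α (x + 1) k + A2 α β N x * pochRatio α (x - 1) k
        + A0 α β N x * pochRatio α x k
        - n * (N - β - n) * ((x - α) * pochRatio α x k - x * pochRatio α (x - 1) k)) =
      -((x - α) * hahnCoeff β N n m * ((m - n) * (β + n - N + m)) *
        (pochRatio α x m - pochRatio α x (m + 1))) := by
  have h0 : α - x ≠ 0 := by simpa using hx 0
  induction m with
  | zero =>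
    rw [Finset.sum_range_one, mul_pochRatio_sub_one h0]
    simp only [pochRatio, poch, A0, A1, A2, Finset.prod_range_zero]
    push_cast
    ring
  | succ m ih =>
    rw [Finset.sum_range_succ, ih (by omega), hahn_Y_pochRatio_succ β N hx,
      mul_pochRatio_sub_one h0]
    have h := hahnCoeff_succ β n (show m < N by omega)
    push_cast
    linear_combination (x - α) * (pochRatio α x m - pochRatio α x (m + 1)) * h

theorem statement4 (N : ℕ) (hN : 0 < N) (α β : ℝ)
    (hα : ∀ m : ℤ, α ≠ (m : ℝ)) (hβ : ∀ m : ℤ, β ≠ (m : ℝ))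
    (n : ℕ) (hn : n ≤ N) (x : ℤ) :
    A1 α β N (x : ℝ) * U α β N n (x + 1) + A2 α β N (x : ℝ) * U α β N n (x - 1)
      + A0 α β N (x : ℝ) * U α β N n x =
    (n : ℝ) * ((N : ℝ) - β - (n : ℝ)) *
      (((x : ℝ) - α) * U α β N n x - (x : ℝ) * U α β N n (x - 1)) := by
  have hx : ∀ m : ℤ, α - x + m ≠ 0 := fun m h => hα (x - m) (by push_cast; linarith)
  have key := sum_hahn_sub_eigen β n hx hn
  simp only [sub_self, zero_mul, mul_zero, neg_zero] at key
  simp only [U_eq_sum]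
  push_cast
  rw [← sub_eq_zero]
  refine Eq.trans ?_ ((congrArg
    (((-1 : ℝ) ^ n * poch (-(N : ℝ)) n / poch (β + 1) n) * ·) key).trans (mul_zero _))
  simp only [Finset.mul_sum, ← Finset.sum_add_distrib, ← Finset.sum_sub_distrib]
  refine Finset.sum_congr rfl fun k _ => ?_
  ring
end

section
/- In the difference-operator realization, the Casimir element takes the scalar value α(β − α)/2: let X, Z be the lower bidiagonal (N+1)×(N+1) real matrices with entries X_{k,k} = k − α, X_{k,k−1} = −k, Z_{k,k} = −1, Z_{k,k−1} = k/(k − α) (all other entries zero), and let Y be the tridiagonal (N+1)×(N+1) matrix with entries Y_{k,k} = A₀(k), Y_{k,k+1} = A₁(k), Y_{k,k−1} = A₂(k), where rows and columns are indexed by k = 0, 1, …, N. Then the matrix Q = X³ + ξ₁ Z³ + (ξ₁/2){X², Z} + 2{X, Z²} + (1/2){Y, Z²} + (ξ₄/2) X² + ((ξ₁ + ξ₃ + ξ₄)/2) Z² + ((ξ₂ + 3)/2){X, Z} + (1/2){Y, Z} + (ξ₀ + 1/2) X + (ξ₀ + ξ₄/2) Z equals (α(β − α)/2) times the identity matrix,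 where ξ₀ = α(α − β), ξ₁ = N − β, ξ₂ = 1 + α(1 + N − β), ξ₃ = α + (α+1)(N − β), ξ₄ = 4α − 2β − 1. -/
/-- The lower bidiagonal matrix representing the operator `X` in the standard basis:
`X_{k,k} = k - α`, `X_{k,k-1} = -k`. -/
noncomputable def Xmat (N : ℕ) (α : ℝ) : Matrix (Fin (N + 1)) (Fin (N + 1)) ℝ :=
  fun i j =>
    if (i : ℕ) = (j : ℕ) then (i : ℝ) - α
    else if (i : ℕ) = (j : ℕ) + 1 then -(i : ℝ)
    else 0

/-- The lower bidiagonal matrix representing the operator `Z` in the standard basis: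
`Z_{k,k} = -1`, `Z_{k,k-1} = k/(k-α)`. -/
noncomputable def Zmat (N : ℕ) (α : ℝ) : Matrix (Fin (N + 1)) (Fin (N + 1)) ℝ :=
  fun i j =>
    if (i : ℕ) = (j : ℕ) then -1
    else if (i : ℕ) = (j : ℕ) + 1 then (i : ℝ) / ((i : ℝ) - α)
    else 0

/-- The tridiagonal matrix representing the operator `Y` in the standard basis:
`Y_{k,k} = A₀(k)`, `Y_{k,k+1} = A₁(k)`, `Y_{k,k-1} = A₂(k)`. -/
noncomputable def Ymat (N : ℕ) (α β : ℝ) : Matrix (Fin (N + 1)) (Fin (N + 1)) ℝ :=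
  fun i j =>
    if (i : ℕ) = (j : ℕ) then A0 α β N (i : ℝ)
    else if (j : ℕ) = (i : ℕ) + 1 then A1 α β N (i : ℝ)
    else if (i : ℕ) = (j : ℕ) + 1 then A2 α β N (i : ℝ)
    else 0

open Matrix

/-- A tridiagonal matrix whose coefficients vanish at the two ends of `0, …, N` acts on samples of
`f` at the integers as the corresponding difference operator. -/
theorem tridiagonal_mulVec_sample (N : ℕ) (a b c : ℝ → ℝ) (hb : b N = 0) (hc : c 0 = 0)
    (f : ℝ → ℝ) :
    (Matrix.of fun i j : Fin (N + 1) =>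
        if (i : ℕ) = (j : ℕ) then a i
        else if (j : ℕ) = (i : ℕ) + 1 then b i
        else if (i : ℕ) = (j : ℕ) + 1 then c i
        else 0) *ᵥ (fun i : Fin (N + 1) => f (i : ℕ))
      = fun i : Fin (N + 1) => a i * f i + b i * f (i + 1) + c i * f (i - 1) := by
  ext ⟨i, hi⟩
  have key : ∀ j : ℕ, (if i = j then a i else if j = i + 1 then b i
        else if i = j + 1 then c i else 0) * f j
      = (if i = j then a i * f i else 0) + (if i + 1 = j then b i * f (i + 1) else 0)
        + (if i - 1 = j then c i * f (i - 1) else 0) := by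
    intro j
    rcases i with _ | m
    · rcases j with _ | _ | j <;> simp [hc]
    · have hm : m ≠ m + 1 + 1 := by omega
      by_cases h0 : m + 1 = j
      · subst h0; simp
      · by_cases h1 : m + 1 + 1 = j
        · subst h1; simp [hm]
        · by_cases h2 : m = j
          · subst h2; simp [hm, hm.symm]
          · simp [h0, h1, h2, Ne.symm h1]
  simp only [mulVec, dotProduct, of_apply, key, Finset.sum_add_distrib]
  rw [Fin.sum_univ_eq_sum_range (fun j => if i = j then a i * f i else 0),
    Fin.sum_univ_eq_sum_range (fun j => if i + 1 = j then b i * f (i + 1) else 0),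
    Fin.sum_univ_eq_sum_range (fun j => if i - 1 = j then c i * f (i - 1) else 0)]
  simp only [Finset.sum_ite_eq, Finset.mem_range, hi, if_true, show i - 1 < N + 1 by omega]
  congr 2
  split_ifs with h
  · rfl
  · obtain rfl : i = N := by omega
    simp [hb]

/-- The difference operator `X`. -/
def diffX (α : ℝ) (f : ℝ → ℝ) (x : ℝ) : ℝ := (x - α) * f x - x * f (x - 1)

/-- The difference operator `Z`. -/
noncomputable def diffZ (α : ℝ) (f : ℝ → ℝ) (x : ℝ) : ℝ := -f x + x / (x - α) * f (x - 1)

/-- The difference operator `Y`. -/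
noncomputable def diffY (N : ℕ) (α β : ℝ) (f : ℝ → ℝ) (x : ℝ) : ℝ :=
  A0 α β N x * f x + A1 α β N x * f (x + 1) + A2 α β N x * f (x - 1)

theorem Xmat_mulVec_sample (N : ℕ) (α : ℝ) (f : ℝ → ℝ) :
    Xmat N α *ᵥ (fun i : Fin (N + 1) => f (i : ℕ)) = fun i : Fin (N + 1) => diffX α f i := by
  have h := tridiagonal_mulVec_sample N (fun x => x - α) (fun _ => 0) (fun x => -x) rfl neg_zero f
  convert h using 2
  · ext i j
    simp only [Xmat, of_apply]
    split_ifs <;> first | rfl | omega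
  · simp only [diffX]; ring

theorem Zmat_mulVec_sample (N : ℕ) (α : ℝ) (f : ℝ → ℝ) :
    Zmat N α *ᵥ (fun i : Fin (N + 1) => f (i : ℕ)) = fun i : Fin (N + 1) => diffZ α f i := by
  have h := tridiagonal_mulVec_sample N (fun _ => -1) (fun _ => 0) (fun x => x / (x - α)) rfl
    (zero_div _) f
  convert h using 2
  · ext i j
    simp only [Zmat, of_apply]
    split_ifs <;> first | rfl | omega
  · simp only [diffZ]; ring

theorem Ymat_mulVec_sample (N : ℕ) (α β : ℝ) (f : ℝ → ℝ) :
    Ymat N α β *ᵥ (fun i : Fin (N + 1) => f (i : ℕ)) = fun i : Fin (N + 1) => diffY N α β f i :=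
  tridiagonal_mulVec_sample N (A0 α β N) (A1 α β N) (A2 α β N) (by simp [A1]) (by simp [A2]) f

/-- The Casimir element acts as a scalar in the realization by difference operators. -/
theorem diff_casimir (N : ℕ) (α β x : ℝ) (f : ℝ → ℝ) (h0 : x + 1 - α ≠ 0) (h1 : x - α ≠ 0)
    (h2 : x - 1 - α ≠ 0) (h3 : x - 2 - α ≠ 0) (ξ₀ ξ₁ ξ₂ ξ₃ ξ₄ : ℝ)
    (hξ₀ : ξ₀ = α * (α - β)) (hξ₁ : ξ₁ = (N : ℝ) - β)
    (hξ₂ : ξ₂ = 1 + α * (1 + (N : ℝ) - β)) (hξ₃ : ξ₃ = α + (α + 1) * ((N : ℝ) - β))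
    (hξ₄ : ξ₄ = 4 * α - 2 * β - 1) :
    diffX α (diffX α (diffX α f)) x + ξ₁ * diffZ α (diffZ α (diffZ α f)) x
      + (ξ₁ / 2) * (diffX α (diffX α (diffZ α f)) x + diffZ α (diffX α (diffX α f)) x)
      + 2 * (diffX α (diffZ α (diffZ α f)) x + diffZ α (diffZ α (diffX α f)) x)
      + (1 / 2) * (diffY N α β (diffZ α (diffZ α f)) x + diffZ α (diffZ α (diffY N α β f)) x)
      + (ξ₄ / 2) * diffX α (diffX α f) x + ((ξ₁ + ξ₃ + ξ₄) / 2) * diffZ α (diffZ α f) x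
      + ((ξ₂ + 3) / 2) * (diffX α (diffZ α f) x + diffZ α (diffX α f) x)
      + (1 / 2) * (diffY N α β (diffZ α f) x + diffZ α (diffY N α β f) x)
      + (ξ₀ + 1 / 2) * diffX α f x + (ξ₀ + ξ₄ / 2) * diffZ α f x
      = α * (β - α) / 2 * f x := by
  subst hξ₀ hξ₁ hξ₂ hξ₃ hξ₄
  have e : x - 1 - 1 = x - 2 := by ring
  have e' : x - 2 - 1 = x - 3 := by ring
  have e'' : x - 2 + 1 = x - 1 := by ring
  simp only [diffX, diffY, diffZ, A0, A1, A2, e, e', e'', sub_add_cancel, add_sub_cancel_right]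
  generalize f (x + 1) = f1, f x = f0, f (x - 1) = g1, f (x - 2) = g2, f (x - 3) = g3
  field_simp
  ring

theorem statement18 (N : ℕ) (hN : 0 < N) (α β : ℝ) (hα : ∀ m : ℤ, α ≠ (m : ℝ))
    (X Y Z : Matrix (Fin (N + 1)) (Fin (N + 1)) ℝ)
    (hX : X = Xmat N α) (hY : Y = Ymat N α β) (hZ : Z = Zmat N α)
    (ξ₀ ξ₁ ξ₂ ξ₃ ξ₄ : ℝ)
    (hξ₀ : ξ₀ = α * (α - β)) (hξ₁ : ξ₁ = (N : ℝ) - β)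
    (hξ₂ : ξ₂ = 1 + α * (1 + (N : ℝ) - β)) (hξ₃ : ξ₃ = α + (α + 1) * ((N : ℝ) - β))
    (hξ₄ : ξ₄ = 4 * α - 2 * β - 1)
    (Q : Matrix (Fin (N + 1)) (Fin (N + 1)) ℝ)
    (hQ : Q = X ^ 3 + ξ₁ • Z ^ 3 + (ξ₁ / 2) • (X ^ 2 * Z + Z * X ^ 2)
      + (2 : ℝ) • (X * Z ^ 2 + Z ^ 2 * X) + (1 / 2 : ℝ) • (Y * Z ^ 2 + Z ^ 2 * Y)
      + (ξ₄ / 2) • X ^ 2 + ((ξ₁ + ξ₃ + ξ₄) / 2) • Z ^ 2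
      + ((ξ₂ + 3) / 2) • (X * Z + Z * X) + (1 / 2 : ℝ) • (Y * Z + Z * Y)
      + (ξ₀ + 1 / 2) • X + (ξ₀ + ξ₄ / 2) • Z) :
    Q = (α * (β - α) / 2) • (1 : Matrix (Fin (N + 1)) (Fin (N + 1)) ℝ) := by
  have hne : ∀ (i : ℕ) (m : ℤ), (i : ℝ) + m - α ≠ 0 := fun i m h =>
    hα (i + m) (by push_cast; linarith)
  refine Matrix.ext_of_mulVec_single fun j => ?_
  obtain ⟨f, hf⟩ : ∃ f : ℝ → ℝ, (fun i : Fin (N + 1) => f (i : ℕ)) = Pi.single j 1 :=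
    ⟨Function.extend (fun i : Fin (N + 1) => ((i : ℕ) : ℝ)) (Pi.single j 1) 0,
      funext fun i => Function.Injective.extend_apply
        (Nat.cast_injective.comp Fin.val_injective) _ _ i⟩
  rw [← hf, hQ, hX, hY, hZ]
  simp only [pow_succ, pow_zero, one_mul, add_mulVec, smul_mulVec, ← mulVec_mulVec,
    Xmat_mulVec_sample, Ymat_mulVec_sample, Zmat_mulVec_sample, one_mulVec]
  ext i
  simp only [Pi.add_apply, Pi.smul_apply, smul_eq_mul]
  refine diff_casimir N α β i f ?_ ?_ ?_ ?_ ξ₀ ξ₁ ξ₂ ξ₃ ξ₄ hξ₀ hξ₁ hξ₂ hξ₃ hξ₄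
  · simpa using hne i 1
  · simpa using hne i 0
  · simpa [sub_eq_add_neg] using hne i (-1)
  · simpa [sub_eq_add_neg] using hne i (-2)
end
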